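/- arXiv:2208.06539 — 2 statements merged into one kernel-verified Lean document; each statement's English description precedes it below -/
import Mathlib

section
/- A sequence of finite signed measures μ_n on a measurable space converges setwise (i.e., μ_n(A) → μ(A) for every measurable set A) if and only if it converges weakly in the Banach space of signed measures with total variation norm (i.e., ℓ(μ_n) → ℓ(μ) for every continuous linear functional ℓ). -/
open MeasureTheory

/-- The total variation norm of a finite signed measure. -/
noncomputable def tvNorm {X : Type*} [MeasurableSpace X] (s : SignedMeasure X) : ℝ :=
  (s.totalVariation Set.univ).toReal

/-- If a signed measure is bounded by `M` on all sets, its total variation is at most `2 M`. -/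
lemma tvNorm_le_of_forall {X : Type*} [MeasurableSpace X] (s : SignedMeasure X) (M : ℝ)
    (h : ∀ A, MeasurableSet A → |s A| ≤ M) : tvNorm s ≤ 2 * M := by
  obtain ⟨i, hi, hpos, hneg, hp, hn⟩ := s.toJordanDecomposition_spec
  have h1 : s.toJordanDecomposition.posPart.real Set.univ = s i := by
    rw [hp, Measure.real, SignedMeasure.toMeasureOfZeroLE_apply _ hpos hi MeasurableSet.univ]
    simp
  have h2 : s.toJordanDecomposition.negPart.real Set.univ = - s iᶜ := by
    rw [hn, Measure.real, SignedMeasure.toMeasureOfLEZero_apply _ hneg hi.compl MeasurableSet.univ]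
    simp
  have h3 : tvNorm s = s i + - s iᶜ := by
    rw [← h1, ← h2, tvNorm, SignedMeasure.totalVariation, ← Measure.real, measureReal_add_apply]
  have h4 := abs_le.1 (h i hi)
  have h5 := abs_le.1 (h iᶜ hi.compl)
  linarith [h4.2, h5.1]

/-- Baire category step: pointwise bounded signed measures are uniformly bounded on all but
finitely many terms of a disjoint sequence. -/
lemma disjoint_seq_bound {X : Type*} [MeasurableSpace X] (μ : ℕ → SignedMeasure X)
    (hb : ∀ A, MeasurableSet A → ∃ M : ℝ, ∀ n, |μ n A| ≤ M)
    (A : ℕ → Set X) (hA : ∀ k, MeasurableSet (A k)) (hd : Pairwise (Function.onFun Disjoint A)) :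
    ∃ M : ℝ, ∃ N : ℕ, ∀ k, N ≤ k → ∀ n, |μ n (A k)| ≤ M := by
  let B : (ℕ → Bool) → ℕ → Set X := fun S k => if S k then A k else ∅
  have hB : ∀ S k, MeasurableSet (B S k) := by
    intro S k; by_cases h : S k <;> simp [B, h, hA]
  have hBd : ∀ S, Pairwise (Function.onFun Disjoint (B S)) := by
    intro S i j hij
    have := hd hij
    by_cases h : S i <;> by_cases hj : S j <;> simp_all [B, Function.onFun]
  let φ : ℕ → (ℕ → Bool) → ℝ := fun n S => μ n (⋃ k, B S k)
  have hφ : ∀ n S, HasSum (fun k => μ n (B S k)) (φ n S) := fun n S =>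
    (μ n).m_iUnion (hB S) (hBd S)
  have hval : ∀ n S k, μ n (B S k) = if S k then μ n (A k) else 0 := by
    intro n S k; by_cases h : S k <;> simp [B, h]
  have hcont : ∀ n, Continuous (φ n) := by
    intro n
    have : φ n = fun S => ∑' k, μ n (B S k) := by
      funext S; exact (hφ n S).tsum_eq.symm
    rw [this]
    have hsum : Summable (fun k => |μ n (A k)|) := ((μ n).m_iUnion hA hd).summable.abs
    refine continuous_tsum (u := fun k => |μ n (A k)|) ?_ hsum ?_
    · intro k
      simp only [hval]
      exact (continuous_of_discreteTopology (f := fun b : Bool => if b then μ n (A k) else 0)).comp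
        (continuous_apply k)
    · intro k S
      rw [hval]; by_cases h : S k <;> simp [h]
  let F : ℕ → Set (ℕ → Bool) := fun m => {S | ∀ n, |φ n S| ≤ m}
  have hFc : ∀ m, IsClosed (F m) := by
    intro m
    have : F m = ⋂ n, {S | |φ n S| ≤ m} := by ext; simp [F]
    rw [this]
    exact isClosed_iInter fun n => isClosed_le (hcont n).abs continuous_const
  have hFU : ⋃ m, F m = Set.univ := by
    refine Set.eq_univ_of_forall fun S => ?_
    obtain ⟨M, hM⟩ := hb (⋃ k, B S k) (MeasurableSet.iUnion (hB S))
    obtain ⟨m, hm⟩ := exists_nat_ge M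
    exact Set.mem_iUnion.2 ⟨m, fun n => (hM n).trans hm⟩
  obtain ⟨m, S, hS⟩ := nonempty_interior_of_iUnion_of_closed hFc hFU
  obtain ⟨I, u, hu, hIu⟩ := isOpen_pi_iff.1 isOpen_interior S hS
  obtain ⟨N, hN⟩ : ∃ N, ∀ i ∈ I, i < N := ⟨I.sup id + 1, fun i hi =>
    Nat.lt_succ_of_le (Finset.le_sup (f := id) hi)⟩
  refine ⟨2 * m, N, fun k hk n => ?_⟩
  have hmem : ∀ b, Function.update S k b ∈ F m := by
    intro b
    refine interior_subset (hIu ?_)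
    intro i hi
    have : i ≠ k := by have := hN i hi; omega
    rw [Function.update_of_ne this]
    exact (hu i hi).2
  have h1 := abs_le.1 (hmem true n)
  have h0 := abs_le.1 (hmem false n)
  have hdiff : HasSum (fun j => μ n (B (Function.update S k true) j) -
      μ n (B (Function.update S k false) j)) (φ n (Function.update S k true) -
      φ n (Function.update S k false)) := (hφ n _).sub (hφ n _)
  have hs : HasSum (fun j => μ n (B (Function.update S k true) j) -
      μ n (B (Function.update S k false) j)) (μ n (A k)) := by
    convert hasSum_ite_eq k (μ n (A k)) using 2 with j
    simp only [hval]
    by_cases h : j = k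
    · subst h; simp
    · simp [h]
  rw [hs.unique hdiff, abs_le]
  constructor <;> linarith [h1.1, h1.2, h0.1, h0.2]

/-- Nikodym boundedness theorem. -/
lemma nikodym_bound {X : Type*} [MeasurableSpace X] (μ : ℕ → SignedMeasure X)
    (hb : ∀ A, MeasurableSet A → ∃ M : ℝ, ∀ n, |μ n A| ≤ M) :
    ∃ M : ℝ, ∀ n A, MeasurableSet A → |μ n A| ≤ M := by
  let Good : Set X → Prop := fun B => ∃ M : ℝ, ∀ n A, MeasurableSet A → A ⊆ B → |μ n A| ≤ M
  by_contra hcon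
  have hbad : ¬ Good Set.univ := by
    rintro ⟨M, hM⟩
    exact hcon ⟨M, fun n A hA => hM n A hA (Set.subset_univ _)⟩
  have step : ∀ (B : {B : Set X // MeasurableSet B ∧ ¬ Good B}) (K : ℕ), ∃ A : Set X,
      MeasurableSet A ∧ A ⊆ B.1 ∧ (∃ n, (K : ℝ) < |μ n A|) ∧ ¬ Good (B.1 \ A) := by
    rintro ⟨B, hB, hBad⟩ K
    obtain ⟨M, hM⟩ := hb B hB
    have : ∃ n C, MeasurableSet C ∧ C ⊆ B ∧ K + M < |μ n C| := by
      by_contra h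
      push Not at h
      exact hBad ⟨K + M, h⟩
    obtain ⟨n, C, hC, hCB, hlt⟩ := this
    have hM0 : 0 ≤ M := (abs_nonneg _).trans (hM n)
    by_cases hg : Good (B \ C)
    · refine ⟨B \ C, hB.diff hC, Set.sdiff_subset, ⟨n, ?_⟩, ?_⟩
      · have h1 : μ n C + μ n (B \ C) = μ n B :=
          VectorMeasure.of_add_of_sdiff hC hB hCB
        have h2 := hM n
        have h3 : |μ n C| ≤ |μ n B| + |μ n (B \ C)| := by
          rw [show μ n C = μ n B - μ n (B \ C) by linarith]; exact abs_sub _ _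
        linarith
      · rw [Set.sdiff_sdiff_cancel_left hCB]
        rintro ⟨M1, h1⟩
        obtain ⟨M2, h2⟩ := hg
        refine hBad ⟨M1 + M2, fun n A hA hAB => ?_⟩
        have e : μ n (A ∩ C) + μ n (A \ C) = μ n A := by
          have := VectorMeasure.of_add_of_sdiff (v := μ n) (hA.inter hC) hA Set.inter_subset_left
          rwa [Set.sdiff_self_inter] at this
        rw [← e]
        exact (abs_add_le _ _).trans (add_le_add (h1 n _ (hA.inter hC) Set.inter_subset_right)
          (h2 n _ (hA.diff hC) (Set.sdiff_subset_sdiff_left hAB)))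
    · exact ⟨C, hC, hCB, ⟨n, by linarith⟩, hg⟩
  choose f hfm hfs hfn hfg using step
  let T := {B : Set X // MeasurableSet B ∧ ¬ Good B}
  let B : ℕ → T := fun k => Nat.rec (motive := fun _ => T) ⟨Set.univ, MeasurableSet.univ, hbad⟩
    (fun k b => ⟨b.1 \ f b k, b.2.1.diff (hfm b k), hfg b k⟩) k
  have hBs : ∀ k, (B (k + 1)).1 = (B k).1 \ f (B k) k := fun k => rfl
  have hanti : Antitone (fun k => (B k).1) := antitone_nat_of_succ_le fun k => by
    rw [hBs]; exact Set.sdiff_subset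
  have hlt : ∀ i j, i < j → Disjoint (f (B i) i) (f (B j) j) := by
    intro i j hij
    have h1 : f (B j) j ⊆ (B (i + 1)).1 := (hfs _ _).trans (hanti hij)
    rw [hBs] at h1
    exact Set.disjoint_left.2 fun x hx hy => (h1 hy).2 hx
  have hd : Pairwise (Function.onFun Disjoint (fun k => f (B k) k)) := by
    intro i j hij
    rcases lt_or_gt_of_ne hij with h | h
    · exact hlt i j h
    · exact (hlt j i h).symm
  obtain ⟨M, N, hMN⟩ := disjoint_seq_bound μ hb _ (fun k => hfm (B k) k) hd
  obtain ⟨m, hm⟩ := exists_nat_ge M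
  obtain ⟨n, hn⟩ := hfn (B (max m N)) (max m N)
  have h1 := hMN (max m N) (le_max_right _ _) n
  have h2 : (m : ℝ) ≤ ((max m N : ℕ) : ℝ) := by exact_mod_cast le_max_left _ _
  linarith

/-- Uniform approximation of bounded measurable functions by simple functions. -/
lemma simple_approx {X : Type*} [MeasurableSpace X] (g : X → ℝ) (hg : Measurable g) (D : ℝ)
    (hD : ∀ x, |g x| ≤ D) (δ : ℝ) (hδ : 0 < δ) :
    ∃ (I : Finset ℤ) (A : ℤ → Set X), (∀ k, MeasurableSet (A k)) ∧
      ∀ x, |g x - ∑ k ∈ I, (δ * k) * (A k).indicator (fun _ => (1 : ℝ)) x| ≤ δ := by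
  let q : X → ℤ := fun x => ⌊g x / δ⌋
  have hq : Measurable q := (hg.div_const δ).floor
  refine ⟨Finset.Icc ⌊-D / δ⌋ ⌊D / δ⌋, fun k => q ⁻¹' {k}, fun k => hq (measurableSet_singleton k),
    fun x => ?_⟩
  have hx := abs_le.1 (hD x)
  have hmem : q x ∈ Finset.Icc ⌊-D / δ⌋ ⌊D / δ⌋ := by
    rw [Finset.mem_Icc]
    exact ⟨Int.floor_le_floor (by gcongr; exact hx.1), Int.floor_le_floor (by gcongr; exact hx.2)⟩
  rw [Finset.sum_eq_single_of_mem (q x) hmem]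
  · have h1 : (q x : ℝ) ≤ g x / δ := Int.floor_le _
    have h2 : g x / δ < q x + 1 := Int.lt_floor_add_one _
    rw [le_div_iff₀ hδ] at h1
    rw [div_lt_iff₀ hδ] at h2
    simp only [Set.mem_preimage, Set.mem_singleton_iff, Set.indicator_of_mem, mul_one]
    rw [abs_le]; constructor <;> nlinarith
  · intro k _ hk
    rw [Set.indicator_of_notMem, mul_zero]
    simpa using hk.symm

/-- Integral representation of a bounded functional on measures with density. -/
lemma functional_rep {X : Type*} [MeasurableSpace X] (ν : Measure X) [IsFiniteMeasure ν]
    (ℓ : SignedMeasure X →ₗ[ℝ] ℝ) (C : ℝ) (hC : ∀ s : SignedMeasure X, |ℓ s| ≤ C * tvNorm s) :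
    ∃ (g : X → ℝ) (D : ℝ), Measurable g ∧ (∀ x, |g x| ≤ D) ∧
      ∀ f : X → ℝ, Integrable f ν → ℓ (ν.withDensityᵥ f) = ∫ x, f x * g x ∂ν := by
  let K : ℝ := |C| * 2
  have hK : 0 ≤ K := by positivity
  have hbd : ∀ f : X → ℝ, Integrable f ν → |ℓ (ν.withDensityᵥ f)| ≤ K * ∫ x, |f x| ∂ν := by
    intro f hf
    have h1 : tvNorm (ν.withDensityᵥ f) ≤ 2 * ∫ x, |f x| ∂ν := by
      refine tvNorm_le_of_forall _ _ fun A hA => ?_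
      rw [withDensityᵥ_apply hf hA]
      exact (abs_integral_le_integral_abs).trans
        (setIntegral_le_integral hf.abs (Filter.Eventually.of_forall fun x => abs_nonneg _))
    have h0 : 0 ≤ tvNorm (ν.withDensityᵥ f) := ENNReal.toReal_nonneg
    calc _ ≤ C * tvNorm (ν.withDensityᵥ f) := hC _
      _ ≤ |C| * tvNorm (ν.withDensityᵥ f) := by gcongr; exact le_abs_self C
      _ ≤ |C| * (2 * ∫ x, |f x| ∂ν) := by gcongr
      _ = _ := by simp only [K]; ring
  have hint : ∀ A : Set X, MeasurableSet A → Integrable (A.indicator (fun _ => (1 : ℝ))) ν :=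
    fun A hA => (integrable_const 1).indicator hA
  classical
  let m : Set X → ℝ := fun A => if MeasurableSet A then
    ℓ (ν.withDensityᵥ (A.indicator (fun _ => (1 : ℝ)))) else 0
  have hm : ∀ A, MeasurableSet A → m A = ℓ (ν.withDensityᵥ (A.indicator (fun _ => (1 : ℝ)))) :=
    fun A hA => if_pos hA
  have hmb : ∀ A, MeasurableSet A → |m A| ≤ K * ν.real A := by
    intro A hA
    rw [hm A hA]
    refine (hbd _ (hint A hA)).trans (le_of_eq ?_)
    congr 1
    have : ∀ x, |A.indicator (fun _ => (1 : ℝ)) x| = A.indicator (fun _ => (1 : ℝ)) x :=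
      fun x => abs_of_nonneg (Set.indicator_nonneg (fun _ _ => zero_le_one) x)
    simp only [this]
    rw [integral_indicator hA]; simp
  have : IsFiniteMeasure (ENNReal.ofReal K • ν) := ν.smul_finite ENNReal.ofReal_ne_top
  let σ : SignedMeasure X := VectorMeasure.of_additive_of_le_measure
    (μ := ENNReal.ofReal K • ν) m
    (by
      intro A
      by_cases hA : MeasurableSet A
      · rw [Real.enorm_eq_ofReal_abs, Measure.smul_apply, smul_eq_mul, ← ofReal_measureReal,
          ← ENNReal.ofReal_mul hK]
        exact ENNReal.ofReal_le_ofReal (hmb A hA)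
      · simp [m, hA])
    (by
      intro s t hs ht hst
      rw [hm _ (hs.union ht), hm _ hs, hm _ ht, ← map_add,
        ← withDensityᵥ_add (hint s hs) (hint t ht), Set.indicator_union_of_disjoint hst]
      rfl)
    (fun s hs => if_neg hs)
  have hσ : ∀ A, MeasurableSet A → σ A = ℓ (ν.withDensityᵥ (A.indicator (fun _ => (1 : ℝ)))) :=
    fun A hA => hm A hA
  have hσb : ∀ A, MeasurableSet A → |σ A| ≤ K * ν.real A := fun A hA => hmb A hA
  have hac : σ ≪ᵥ ν.toENNRealVectorMeasure := by
    refine VectorMeasure.AbsolutelyContinuous.mk fun A hA h0 => ?_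
    rw [Measure.toENNRealVectorMeasure_apply_measurable hA] at h0
    have := hσb A hA
    rw [measureReal_def, h0] at this
    simpa using this
  have hri : Integrable (σ.rnDeriv ν) ν := SignedMeasure.integrable_rnDeriv _ _
  have hr : ∀ A, MeasurableSet A → ∫ x in A, σ.rnDeriv ν x ∂ν = σ A := by
    intro A hA
    rw [← withDensityᵥ_apply hri hA, SignedMeasure.withDensityᵥ_rnDeriv_eq _ _ hac]
  have hle1 : σ.rnDeriv ν ≤ᵐ[ν] fun _ => K := by
    refine ae_le_of_forall_setIntegral_le hri (integrable_const _) fun A hA _ => ?_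
    rw [hr A hA]
    have := (abs_le.1 (hσb A hA)).2
    simpa [mul_comm] using this
  have hle2 : (fun _ => -K) ≤ᵐ[ν] σ.rnDeriv ν := by
    refine ae_le_of_forall_setIntegral_le (integrable_const _) hri fun A hA _ => ?_
    rw [hr A hA]
    have := (abs_le.1 (hσb A hA)).1
    simpa [mul_comm] using this
  let g : X → ℝ := fun x => max (-K) (min K (σ.rnDeriv ν x))
  have hgm : Measurable g :=
    measurable_const.max (measurable_const.min (SignedMeasure.measurable_rnDeriv σ ν))
  have hgb : ∀ x, |g x| ≤ K := fun x => abs_le.2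
    ⟨le_max_left _ _, max_le (by linarith) (min_le_left _ _)⟩
  have hgr : g =ᵐ[ν] σ.rnDeriv ν := by
    filter_upwards [hle1, hle2] with x h1 h2
    simp only [g]
    rw [min_eq_right h1, max_eq_right h2]
  have hfg : ∀ f : X → ℝ, Integrable f ν → Integrable (fun x => f x * g x) ν := fun f hf =>
    hf.mul_bdd (c := K) hgm.aestronglyMeasurable (Filter.Eventually.of_forall hgb)
  refine ⟨g, K, hgm, hgb, fun f hf => ?_⟩
  refine Integrable.induction (P := fun f => ℓ (ν.withDensityᵥ f) = ∫ x, f x * g x ∂ν)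
    ?_ ?_ ?_ ?_ hf
  · intro c s hs _
    have e : (s.indicator fun _ => c) = c • s.indicator (fun _ => (1 : ℝ)) := by
      ext x; by_cases h : x ∈ s <;> simp [h]
    rw [e, withDensityᵥ_smul, map_smul, ← hσ s hs, ← hr s hs, ← integral_indicator hs, smul_eq_mul,
      ← integral_const_mul]
    refine integral_congr_ae ?_
    filter_upwards [hgr] with x hx
    by_cases h : x ∈ s <;> simp [h, hx]
  · intro f₁ f₂ _ h1 h2 e1 e2
    simp only [Pi.add_apply, add_mul]
    rw [withDensityᵥ_add h1 h2, map_add, e1, e2, integral_add (hfg _ h1) (hfg _ h2)]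
  · refine isClosed_eq ?_ ?_
    · refine LipschitzWith.continuous (K := K.toNNReal) (LipschitzWith.of_dist_le_mul ?_)
      intro u v
      have hu := L1.integrable_coeFn u
      have hv := L1.integrable_coeFn v
      rw [Real.dist_eq, ← map_sub, ← withDensityᵥ_sub hu hv, Real.coe_toNNReal _ hK, dist_eq_norm,
        L1.norm_eq_integral_norm]
      refine (hbd _ (hu.sub hv)).trans (le_of_eq ?_)
      congr 1
      refine integral_congr_ae ?_
      filter_upwards [Lp.coeFn_sub u v] with x hx
      rw [hx]; rfl
    · refine LipschitzWith.continuous (K := K.toNNReal) (LipschitzWith.of_dist_le_mul ?_)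
      intro u v
      have hu := L1.integrable_coeFn u
      have hv := L1.integrable_coeFn v
      rw [Real.dist_eq, ← integral_sub (hfg _ hu) (hfg _ hv), Real.coe_toNNReal _ hK, dist_eq_norm,
        L1.norm_eq_integral_norm, ← integral_const_mul]
      refine (abs_integral_le_integral_abs).trans (integral_mono_ae
        ((hfg _ hu).sub (hfg _ hv)).abs ((L1.integrable_coeFn (u - v)).norm.const_mul K) ?_)
      filter_upwards [Lp.coeFn_sub u v] with x hx
      rw [hx, ← sub_mul, abs_mul, mul_comm]
      exact mul_le_mul_of_nonneg_right (hgb x) (abs_nonneg _)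
  · intro f₁ f₂ hae _ h1
    rw [← WithDensityᵥEq.congr_ae hae, h1]
    refine integral_congr_ae ?_
    filter_upwards [hae] with x hx
    rw [hx]

/-- Setwise null sequences are weakly null. -/
lemma weak_null {X : Type*} [MeasurableSpace X] (s : ℕ → SignedMeasure X)
    (hs : ∀ A : Set X, MeasurableSet A →
      Filter.Tendsto (fun n => s n A) Filter.atTop (nhds 0))
    (ℓ : SignedMeasure X →ₗ[ℝ] ℝ) (C : ℝ) (hC : ∀ s : SignedMeasure X, |ℓ s| ≤ C * tvNorm s) :
    Filter.Tendsto (fun n => ℓ (s n)) Filter.atTop (nhds 0) := by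
  obtain ⟨M, hM⟩ := nikodym_bound s (by
    intro A hA
    obtain ⟨M, hM⟩ := (hs A hA).abs.bddAbove_range
    exact ⟨M, fun n => hM ⟨n, rfl⟩⟩)
  have hM0 : 0 ≤ M := (abs_nonneg _).trans (hM 0 ∅ MeasurableSet.empty)
  let ν : Measure X := (Measure.sum fun n => (s n).totalVariation).toFinite
  have hac : ∀ n, s n ≪ᵥ ν.toENNRealVectorMeasure := by
    intro n
    refine VectorMeasure.AbsolutelyContinuous.mk fun A hA h0 => ?_
    rw [Measure.toENNRealVectorMeasure_apply_measurable hA] at h0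
    have h1 := absolutelyContinuous_toFinite (Measure.sum fun n => (s n).totalVariation) h0
    rw [Measure.sum_apply _ hA, ENNReal.tsum_eq_zero] at h1
    exact SignedMeasure.null_of_totalVariation_zero _ (h1 n)
  let f : ℕ → X → ℝ := fun n => (s n).rnDeriv ν
  have hfi : ∀ n, Integrable (f n) ν := fun n => SignedMeasure.integrable_rnDeriv _ _
  have hfm : ∀ n, Measurable (f n) := fun n => SignedMeasure.measurable_rnDeriv _ _
  have hf : ∀ n, ν.withDensityᵥ (f n) = s n := fun n =>
    SignedMeasure.withDensityᵥ_rnDeriv_eq _ _ (hac n)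
  have hfA : ∀ n A, MeasurableSet A → ∫ x in A, f n x ∂ν = s n A := by
    intro n A hA
    rw [← hf n, withDensityᵥ_apply (hfi n) hA]
  have hfL : ∀ n, ∫ x, |f n x| ∂ν ≤ 2 * M := by
    intro n
    have hP : MeasurableSet {x | 0 ≤ f n x} := measurableSet_le measurable_const (hfm n)
    rw [← integral_add_compl hP (hfi n).abs]
    have e1 : ∫ x in {x | 0 ≤ f n x}, |f n x| ∂ν = s n {x | 0 ≤ f n x} := by
      rw [← hfA n _ hP]
      exact setIntegral_congr_fun hP fun x hx => abs_of_nonneg hx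
    have e2 : ∫ x in {x | 0 ≤ f n x}ᶜ, |f n x| ∂ν = - s n {x | 0 ≤ f n x}ᶜ := by
      rw [← hfA n _ hP.compl, ← integral_neg]
      exact setIntegral_congr_fun hP.compl fun x hx => abs_of_neg (not_le.1 hx)
    rw [e1, e2]
    linarith [(abs_le.1 (hM n _ hP)).2, (abs_le.1 (hM n _ hP.compl)).1]
  obtain ⟨g, D, hgm, hgb, hrep⟩ := functional_rep ν ℓ C hC
  have hfg : ∀ n, Integrable (fun x => f n x * g x) ν := fun n =>
    (hfi n).mul_bdd (c := D) hgm.aestronglyMeasurable (Filter.Eventually.of_forall hgb)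
  rw [Metric.tendsto_atTop]
  intro ε hε
  let δ : ℝ := ε / 2 / (2 * M + 1)
  have hδ : 0 < δ := by positivity
  have hδM : δ * (2 * M) < ε / 2 := by
    have : δ * (2 * M + 1) = ε / 2 := by simp only [δ]; field_simp
    linarith
  obtain ⟨I, A, hA, happ⟩ := simple_approx g hgm D hgb δ hδ
  have hlim : Filter.Tendsto (fun n => ∑ k ∈ I, (δ * k) * s n (A k)) Filter.atTop (nhds 0) := by
    have : Filter.Tendsto (fun n => ∑ k ∈ I, (δ * k) * s n (A k)) Filter.atTop
        (nhds (∑ k ∈ I, (δ * (k : ℝ)) * 0)) :=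
      tendsto_finsetSum _ fun k _ => (hs (A k) (hA k)).const_mul _
    simpa using this
  obtain ⟨N, hN⟩ := Metric.tendsto_atTop.1 hlim (ε / 2) (half_pos hε)
  refine ⟨N, fun n hn => ?_⟩
  have h1 := hN n hn
  rw [Real.dist_eq, sub_zero] at h1 ⊢
  have hind : ∀ k, Integrable (fun x => (δ * k) * (A k).indicator (f n) x) ν := fun k =>
    ((hfi n).indicator (hA k)).const_mul _
  have hsum : ∑ k ∈ I, (δ * k) * s n (A k) =
      ∫ x, ∑ k ∈ I, (δ * k) * (A k).indicator (f n) x ∂ν := by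
    rw [integral_finsetSum _ fun k _ => hind k]
    refine Finset.sum_congr rfl fun k _ => ?_
    rw [integral_const_mul, integral_indicator (hA k), hfA n _ (hA k)]
  have hsi : Integrable (fun x => ∑ k ∈ I, (δ * k) * (A k).indicator (f n) x) ν :=
    integrable_finsetSum _ fun k _ => hind k
  have hdiff : |ℓ (s n) - ∑ k ∈ I, (δ * k) * s n (A k)| ≤ δ * (2 * M) := by
    rw [hsum, ← hf n, hrep _ (hfi n), ← integral_sub (hfg n) hsi]
    calc _ ≤ ∫ x, |f n x * g x - ∑ k ∈ I, (δ * k) * (A k).indicator (f n) x| ∂ν :=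
          abs_integral_le_integral_abs
      _ ≤ ∫ x, δ * |f n x| ∂ν := by
          refine integral_mono ((hfg n).sub hsi).abs ((hfi n).abs.const_mul δ) fun x => ?_
          have e : f n x * g x - ∑ k ∈ I, (δ * k) * (A k).indicator (f n) x =
              (g x - ∑ k ∈ I, (δ * k) * (A k).indicator (fun _ => (1 : ℝ)) x) * f n x := by
            rw [sub_mul, Finset.sum_mul, mul_comm (g x)]
            congr 1
            refine Finset.sum_congr rfl fun k _ => ?_
            by_cases h : x ∈ A k <;> simp [h]
          simp only [e, abs_mul]
          exact mul_le_mul_of_nonneg_right (happ x) (abs_nonneg _)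
      _ = δ * ∫ x, |f n x| ∂ν := integral_const_mul _ _
      _ ≤ _ := by gcongr; exact hfL n
  have := abs_sub_abs_le_abs_sub (ℓ (s n)) (∑ k ∈ I, (δ * k) * s n (A k))
  linarith

/-- A sequence of finite signed measures converges setwise (on every measurable set) if and
only if it converges weakly in the Banach space of signed measures with the total variation
norm, i.e. `ℓ (μ n) → ℓ μ` for every linear functional `ℓ` that is bounded with respect to
the total variation norm. -/
theorem setwise_tendsto_iff_weak_tendsto {X : Type*} [MeasurableSpace X]
    (μn : ℕ → SignedMeasure X) (μ : SignedMeasure X) :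
    (∀ A : Set X, MeasurableSet A →
      Filter.Tendsto (fun n => μn n A) Filter.atTop (nhds (μ A))) ↔
    (∀ ℓ : SignedMeasure X →ₗ[ℝ] ℝ, (∃ C : ℝ, ∀ s : SignedMeasure X, |ℓ s| ≤ C * tvNorm s) →
      Filter.Tendsto (fun n => ℓ (μn n)) Filter.atTop (nhds (ℓ μ))) := by
  constructor
  · rintro h ℓ ⟨C, hC⟩
    have h0 := weak_null (fun n => μn n - μ) (by
      intro A hA
      have := (h A hA).sub_const (μ A)
      simpa using this) ℓ C hC
    have h1 := h0.add_const (ℓ μ)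
    simpa using h1
  · intro h A hA
    let ℓ : SignedMeasure X →ₗ[ℝ] ℝ :=
      { toFun := fun s => s A
        map_add' := fun s t => rfl
        map_smul' := fun c s => rfl }
    refine h ℓ ⟨1, fun s => ?_⟩
    rw [one_mul]
    exact (s.norm_le_totalVariation A).trans (measureReal_mono (Set.subset_univ _))
end

section
/- Let p ≥ 1 and suppose a family of finite measures μ(t) = f(t)·ν on (a,b), dominated by a σ-finite measure ν, is L^p-differentiable at t₀, meaning t ↦ f(t)^{1/p} is differentiable as a map into L^p(ν) at t₀. Then the family is differentiable at t₀ in the total variation norm. -/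
open MeasureTheory

lemma aux_young (p : ℝ) (hp : 1 ≤ p) (ε : ℝ) (hε : 0 < ε) :
    ∃ K : ℝ, 0 ≤ K ∧ ∀ b k : ℝ, 0 ≤ b → 0 ≤ k →
      b ^ (p - 1) * k ≤ ε * b ^ p + K * k ^ p := by
  refine ⟨(ε⁻¹) ^ (p - 1), by positivity, fun b k hb hk => ?_⟩
  have split : ∀ c : ℝ, 0 ≤ c → c ^ p = c ^ (p - 1) * c := by
    intro c hc
    conv_lhs => rw [show p = (p - 1) + 1 by ring]
    rw [Real.rpow_add_one' hc (by linarith)]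
  rcases le_total k (ε * b) with h | h
  · have : b ^ (p - 1) * k ≤ b ^ (p - 1) * (ε * b) := by gcongr
    have h2 : 0 ≤ (ε⁻¹) ^ (p - 1) * k ^ p := by positivity
    rw [split b hb]; nlinarith
  · have hb' : b ≤ ε⁻¹ * k := by
      rw [inv_mul_eq_div, le_div_iff₀ hε]; linarith
    have h1 : b ^ (p - 1) ≤ (ε⁻¹ * k) ^ (p - 1) :=
      Real.rpow_le_rpow hb hb' (by linarith)
    rw [Real.mul_rpow (by positivity) hk] at h1
    have h2 : 0 ≤ ε * b ^ p := by positivity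
    have := mul_le_mul_of_nonneg_right h1 hk
    rw [split k hk]; nlinarith

lemma aux_taylor (p : ℝ) (hp : 1 ≤ p) (ε : ℝ) (hε : 0 < ε) :
    ∃ C : ℝ, 0 ≤ C ∧ (p = 1 → C = 0) ∧ ∀ a b : ℝ, 0 ≤ a → 0 ≤ b →
      |a ^ p - b ^ p - p * b ^ (p - 1) * (a - b)| ≤
        ε * (b ^ (p - 1) * |a - b|) + C * |a - b| ^ p := by
  by_cases hp1 : p = 1
  · subst hp1
    refine ⟨0, le_rfl, fun _ => rfl, fun a b ha hb => ?_⟩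
    simp
    positivity
  have split : ∀ c : ℝ, 0 ≤ c → c ^ p = c ^ (p - 1) * c := by
    intro c hc
    conv_lhs => rw [show p = (p - 1) + 1 by ring]
    rw [Real.rpow_add_one' hc (by linarith)]
  have hd : HasDerivAt (fun x : ℝ => x ^ p) (p * 1 ^ (p - 1)) 1 :=
    Real.hasDerivAt_rpow_const (Or.inl one_ne_zero)
  rw [Real.one_rpow, mul_one, hasDerivAt_iff_isLittleO, Asymptotics.isLittleO_iff] at hd
  obtain ⟨δ, hδ, hball⟩ := Metric.eventually_nhds_iff.1 (hd hε)
  set M : ℝ := 2 / δ + 1 with hM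
  have hM0 : 0 < M := by positivity
  refine ⟨2 * M ^ p + p * M ^ (p - 1), by positivity, fun h => absurd h hp1,
    fun a b ha hb => ?_⟩
  set k := |a - b| with hk
  have hk0 : 0 ≤ k := abs_nonneg _
  by_cases hc : k < δ * b
  · have hb0 : 0 < b := by
      by_contra hcon
      have : b = 0 := le_antisymm (not_lt.1 hcon) hb
      subst this; simp at hc; linarith
    have hx : dist (a / b) 1 < δ := by
      rw [Real.dist_eq, show a / b - 1 = (a - b) / b by field_simp, abs_div, abs_of_pos hb0,
        div_lt_iff₀ hb0]
      exact hc
    have := hball hx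
    simp only [Real.one_rpow, smul_eq_mul, Real.norm_eq_abs] at this
    have hbp : 0 < b ^ p := Real.rpow_pos_of_pos hb0 p
    have e1 : a ^ p - b ^ p - p * b ^ (p - 1) * (a - b) =
        b ^ p * ((a / b) ^ p - 1 - (a / b - 1) * p) := by
      rw [Real.div_rpow ha hb]
      have : b ^ p * ((a / b - 1) * p) = p * b ^ (p - 1) * (a - b) := by
        rw [split b hb]; field_simp
      rw [mul_sub (b ^ p) _ ((a / b - 1) * p), this]
      field_simp
    have e2 : b ^ (p - 1) * k = b ^ p * |a / b - 1| := by
      rw [show a / b - 1 = (a - b) / b by field_simp, abs_div, abs_of_pos hb0, split b hb]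
      field_simp
      rw [hk]
    rw [e1, e2, abs_mul, abs_of_pos hbp]
    have h3 := mul_le_mul_of_nonneg_left this hbp.le
    have h4 : 0 ≤ (2 * M ^ p + p * M ^ (p - 1)) * k ^ p := by positivity
    nlinarith
  · push Not at hc
    have hb1 : b ≤ k / δ := by rw [le_div_iff₀ hδ]; linarith
    have hkd : 0 ≤ k / δ := by positivity
    have hbM : b ≤ M * k := by
      rw [hM, add_mul, show 2 / δ * k = 2 * (k / δ) by ring]; linarith
    have haM : a ≤ M * k := by
      have : a ≤ b + k := by have := le_abs_self (a - b); linarith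
      rw [hM, add_mul, show 2 / δ * k = 2 * (k / δ) by ring]; linarith
    have h1 : a ^ p ≤ M ^ p * k ^ p := by
      rw [← Real.mul_rpow hM0.le hk0]; exact Real.rpow_le_rpow ha haM (by linarith)
    have h2 : b ^ p ≤ M ^ p * k ^ p := by
      rw [← Real.mul_rpow hM0.le hk0]; exact Real.rpow_le_rpow hb hbM (by linarith)
    have h3 : b ^ (p - 1) ≤ M ^ (p - 1) * k ^ (p - 1) := by
      rw [← Real.mul_rpow hM0.le hk0]; exact Real.rpow_le_rpow hb hbM (by linarith)
    have h4 : p * b ^ (p - 1) * k ≤ p * M ^ (p - 1) * k ^ p := by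
      rw [split k hk0]
      calc p * b ^ (p - 1) * k ≤ p * (M ^ (p - 1) * k ^ (p - 1)) * k := by gcongr
        _ = _ := by ring
    have h5 : |a ^ p - b ^ p - p * b ^ (p - 1) * (a - b)| ≤
        a ^ p + b ^ p + p * b ^ (p - 1) * k := by
      refine (abs_sub _ _).trans ?_
      rw [abs_mul, abs_of_nonneg (show 0 ≤ p * b ^ (p - 1) by positivity)]
      gcongr
      refine (abs_sub _ _).trans ?_
      rw [abs_of_nonneg (by positivity), abs_of_nonneg (by positivity)]
    have h6 : 0 ≤ ε * (b ^ (p - 1) * k) := by positivity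
    nlinarith

lemma aux_pointwise (p : ℝ) (hp : 1 ≤ p) (ε : ℝ) (hε : 0 < ε) :
    ∃ C K : ℝ, (p = 1 → C = 0) ∧ ∀ a b h d s : ℝ, 0 ≤ a → 0 ≤ b → s ≠ 0 →
      h = s⁻¹ * (a - b) →
      |s⁻¹ * (a ^ p - b ^ p) - p * b ^ (p - 1) * d| ≤
        ε * (2 * b ^ p) + (C * |s| ^ (p - 1) + ε) * |h| ^ p + K * |h - d| ^ p := by
  obtain ⟨K, hK, hY⟩ := aux_young p hp (ε / p) (by positivity)
  obtain ⟨K1, hK1, hY1⟩ := aux_young p hp 1 one_pos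
  obtain ⟨C, hC, hC1, hT⟩ := aux_taylor p hp (ε / (1 + K1)) (by positivity)
  refine ⟨C, p * K, hC1, fun a b h d s ha hb hs hh => ?_⟩
  have hab : a - b = s * h := by rw [hh]; field_simp
  have hs0 : 0 < |s| := abs_pos.2 hs
  have t := hT a b ha hb
  rw [hab, abs_mul, Real.mul_rpow (abs_nonneg _) (abs_nonneg _)] at t
  have t1 : |s⁻¹ * (a ^ p - b ^ p) - p * b ^ (p - 1) * h| ≤
      ε / (1 + K1) * (b ^ (p - 1) * |h|) + C * |s| ^ (p - 1) * |h| ^ p := by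
    have e : a ^ p - b ^ p - p * b ^ (p - 1) * (s * h) =
        s * (s⁻¹ * (a ^ p - b ^ p) - p * b ^ (p - 1) * h) := by field_simp
    have e2 : |s| ^ p = |s| ^ (p - 1) * |s| := by
      conv_lhs => rw [show p = (p - 1) + 1 by ring]
      rw [Real.rpow_add_one hs0.ne']
    rw [e, abs_mul, e2] at t
    refine le_of_mul_le_mul_left (t.trans (le_of_eq ?_)) hs0
    ring
  have t2 := hY1 b |h| hb (abs_nonneg _)
  have t3 := hY b |h - d| hb (abs_nonneg _)
  have t4 : |s⁻¹ * (a ^ p - b ^ p) - p * b ^ (p - 1) * d| ≤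
      |s⁻¹ * (a ^ p - b ^ p) - p * b ^ (p - 1) * h| + p * (b ^ (p - 1) * |h - d|) := by
    have : s⁻¹ * (a ^ p - b ^ p) - p * b ^ (p - 1) * d =
      (s⁻¹ * (a ^ p - b ^ p) - p * b ^ (p - 1) * h) + p * b ^ (p - 1) * (h - d) := by ring
    rw [this]
    refine (abs_add_le _ _).trans ?_
    rw [abs_mul _ (h - d), abs_of_nonneg (show 0 ≤ p * b ^ (p - 1) by positivity)]
    exact le_of_eq (by ring)
  have t5 : p * (b ^ (p - 1) * |h - d|) ≤ ε * b ^ p + p * K * |h - d| ^ p := by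
    calc _ ≤ p * (ε / p * b ^ p + K * |h - d| ^ p) := by gcongr
      _ = _ := by field_simp
  have t6 : ε / (1 + K1) * (b ^ (p - 1) * |h|) ≤ ε * b ^ p + ε * |h| ^ p := by
    have hbp : 0 ≤ b ^ p := by positivity
    have hhp : 0 ≤ |h| ^ p := by positivity
    calc _ ≤ ε / (1 + K1) * ((1 + K1) * (b ^ p + |h| ^ p)) := by
            refine mul_le_mul_of_nonneg_left ?_ (by positivity)
            nlinarith [mul_nonneg hK1 hbp]
      _ = _ := by field_simp
  linarith

lemma aux_tv {X : Type*} [MeasurableSpace X] (ν : Measure X) (F : X → ℝ) (hF : Integrable F ν) :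
    (SignedMeasure.totalVariation (ν.withDensityᵥ F) Set.univ).toReal ≤ ∫ x, |F x| ∂ν := by
  obtain ⟨i, hi, hi2, hi3, h1, h2⟩ := SignedMeasure.toJordanDecomposition_spec (ν.withDensityᵥ F)
  rw [SignedMeasure.totalVariation, Measure.add_apply,
    ENNReal.toReal_add (measure_ne_top _ _) (measure_ne_top _ _), h1, h2,
    ← measureReal_def, ← measureReal_def,
    SignedMeasure.toMeasureOfZeroLE_real_apply _ hi2 hi MeasurableSet.univ,
    SignedMeasure.toMeasureOfLEZero_real_apply _ hi3 hi.compl MeasurableSet.univ,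
    Set.inter_univ, Set.inter_univ, withDensityᵥ_apply hF hi, withDensityᵥ_apply hF hi.compl,
    ← integral_add_compl hi hF.abs]
  refine add_le_add ?_ ?_
  · exact (le_abs_self _).trans abs_integral_le_integral_abs
  · exact (neg_le_abs _).trans abs_integral_le_integral_abs

lemma aux_lp {X : Type*} [MeasurableSpace X] (ν : Measure X) (p : ℝ) (hp : 1 ≤ p)
    (g : Lp ℝ (ENNReal.ofReal p) ν) :
    Integrable (fun x => |g x| ^ p) ν ∧ ∫ x, |g x| ^ p ∂ν = ‖g‖ ^ p := by
  have h0 : ENNReal.ofReal p ≠ 0 := by simp; linarith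
  have ht : (ENNReal.ofReal p).toReal = p := ENNReal.toReal_ofReal (by linarith)
  have hI := (Lp.memLp g).integrable_norm_rpow h0 ENNReal.ofReal_ne_top
  have hN := (Lp.memLp g).eLpNorm_eq_integral_rpow_norm h0 ENNReal.ofReal_ne_top
  rw [ht] at hI hN
  have hnn : 0 ≤ ∫ x, ‖g x‖ ^ p ∂ν := integral_nonneg fun x => by positivity
  refine ⟨hI, ?_⟩
  rw [Lp.norm_def, hN, ENNReal.toReal_ofReal (by positivity),
    Real.rpow_inv_rpow hnn (by linarith)]
  rfl

/-- If a family of finite measures `μ(t) = f(t)·ν`, dominated by a σ-finite measure `ν`, is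
`L^p`-differentiable at `t₀` (i.e. `t ↦ f(t)^{1/p}` is differentiable as a map into
`L^p(ν)` at `t₀`), then the family is differentiable at `t₀` in the total variation norm. -/
theorem lp_differentiable_implies_tv_differentiable {X : Type*} [MeasurableSpace X]
    (p : ℝ) (hp : 1 ≤ p) [Fact (1 ≤ ENNReal.ofReal p)]
    (ν : Measure X) [SigmaFinite ν]
    (f : ℝ → X → ℝ) (hfnn : ∀ t x, 0 ≤ f t x)
    (μ : ℝ → Measure X)
    (hμ : ∀ t, μ t = ν.withDensity (fun x => ENNReal.ofReal (f t x)))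
    (hfin : ∀ t, IsFiniteMeasure (μ t))
    (t₀ : ℝ)
    (Φ : ℝ → Lp ℝ (ENNReal.ofReal p) ν)
    (hΦ : ∀ t, (Φ t : X → ℝ) =ᵐ[ν] fun x => (f t x) ^ (1 / p))
    (D : Lp ℝ (ENNReal.ofReal p) ν)
    (hD : HasDerivAt Φ D t₀) :
    ∃ μ'' : SignedMeasure X,
      Filter.Tendsto (fun s : ℝ =>
          (((s⁻¹ • (@Measure.toSignedMeasure X _ (μ (t₀ + s)) (hfin _) -
                @Measure.toSignedMeasure X _ (μ t₀) (hfin _))) - μ'').totalVariation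
            Set.univ).toReal)
        (nhdsWithin 0 {0}ᶜ) (nhds 0) := by
  have hp0 : 0 < p := by linarith
  -- the density is the `p`-th power
  have hΦf : ∀ t, ∀ᵐ x ∂ν, 0 ≤ Φ t x ∧ f t x = (Φ t x) ^ p := by
    intro t
    filter_upwards [hΦ t] with x hx
    rw [hx]
    refine ⟨Real.rpow_nonneg (hfnn t x) _, ?_⟩
    rw [one_div, Real.rpow_inv_rpow (hfnn t x) hp0.ne']
  have hfint : ∀ t, Integrable (f t) ν := by
    intro t
    refine (aux_lp ν p hp (Φ t)).1.congr ?_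
    filter_upwards [hΦf t] with x hx
    rw [hx.2, abs_of_nonneg hx.1]
  have hsm : ∀ t, @Measure.toSignedMeasure X _ (μ t) (hfin t) = ν.withDensityᵥ (f t) := by
    intro t
    ext i hi
    rw [withDensityᵥ_apply (hfint t) hi, Measure.toSignedMeasure_apply_measurable hi,
      measureReal_def, hμ t, withDensity_apply _ hi,
      integral_eq_lintegral_of_nonneg_ae (Filter.Eventually.of_forall (hfnn t))
        (hfint t).1.restrict]
  set G : X → ℝ := fun x => p * |Φ t₀ x| ^ (p - 1) * D x with hG
  have hGint : Integrable G ν := by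
    obtain ⟨K, hK, hY⟩ := aux_young p hp 1 one_pos
    have hm : AEStronglyMeasurable G ν := by
      have h1 : AEMeasurable (fun x => Φ t₀ x) ν := (Lp.aestronglyMeasurable _).aemeasurable
      have h2 : AEMeasurable (fun x => D x) ν := (Lp.aestronglyMeasurable _).aemeasurable
      exact (((h1.abs.pow_const (p - 1)).const_mul p).mul h2).aestronglyMeasurable
    refine Integrable.mono' ((((aux_lp ν p hp (Φ t₀)).1.const_mul 1).add
      ((aux_lp ν p hp D).1.const_mul K)).const_mul p) hm ?_
    refine Filter.Eventually.of_forall fun x => ?_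
    have := hY |Φ t₀ x| |D x| (abs_nonneg _) (abs_nonneg _)
    rw [hG, Real.norm_eq_abs, abs_mul, abs_of_nonneg (show 0 ≤ p * |Φ t₀ x| ^ (p - 1) by positivity),
      mul_assoc]
    exact mul_le_mul_of_nonneg_left this hp0.le
  refine ⟨ν.withDensityᵥ G, ?_⟩
  have hslope := hasDerivAt_iff_tendsto_slope_zero.1 hD
  have hFint : ∀ s : ℝ, Integrable (s⁻¹ • (f (t₀ + s) - f t₀) - G) ν := fun s =>
    (((hfint _).sub (hfint _)).smul s⁻¹).sub hGint
  have hrepr : ∀ s : ℝ, s⁻¹ • (@Measure.toSignedMeasure X _ (μ (t₀ + s)) (hfin _) -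
      @Measure.toSignedMeasure X _ (μ t₀) (hfin _)) - ν.withDensityᵥ G =
      ν.withDensityᵥ (s⁻¹ • (f (t₀ + s) - f t₀) - G) := by
    intro s
    rw [hsm, hsm, withDensityᵥ_sub (((hfint _).sub (hfint _)).smul s⁻¹) hGint,
      withDensityᵥ_smul, withDensityᵥ_sub (hfint _) (hfint _)]
  simp_rw [hrepr]
  set H : ℝ → Lp ℝ (ENNReal.ofReal p) ν := fun s => s⁻¹ • (Φ (t₀ + s) - Φ t₀) with hH
  have key : ∀ ε : ℝ, 0 < ε → ∃ C K : ℝ, (p = 1 → C = 0) ∧ ∀ s : ℝ, s ≠ 0 →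
      (SignedMeasure.totalVariation (ν.withDensityᵥ (s⁻¹ • (f (t₀ + s) - f t₀) - G)) Set.univ).toReal ≤
        ε * (2 * ‖Φ t₀‖ ^ p) + (C * |s| ^ (p - 1) + ε) * ‖H s‖ ^ p + K * ‖H s - D‖ ^ p := by
    intro ε hε
    obtain ⟨C, K, hC, hpt⟩ := aux_pointwise p hp ε hε
    refine ⟨C, K, hC, fun s hs => (aux_tv ν _ (hFint s)).trans ?_⟩
    obtain ⟨i1, e1⟩ := aux_lp ν p hp (Φ t₀)
    obtain ⟨i2, e2⟩ := aux_lp ν p hp (H s)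
    obtain ⟨i3, e3⟩ := aux_lp ν p hp (H s - D)
    rw [← e1, ← e2, ← e3, ← integral_const_mul, ← integral_const_mul, ← integral_const_mul,
      ← integral_const_mul, ← integral_add ((i1.const_mul _).const_mul _) (i2.const_mul _)]
    refine le_of_le_of_eq ?_
      (integral_add (((i1.const_mul _).const_mul _).add (i2.const_mul _)) (i3.const_mul _))
    refine integral_mono_ae (hFint s).abs
      ((((i1.const_mul _).const_mul _).add (i2.const_mul _)).add (i3.const_mul _)) ?_
    filter_upwards [hΦf t₀, hΦf (t₀ + s), Lp.coeFn_sub (H s) D,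
      Lp.coeFn_smul s⁻¹ (Φ (t₀ + s) - Φ t₀), Lp.coeFn_sub (Φ (t₀ + s)) (Φ t₀)]
      with x h1 h2 h3 h4 h5
    have h6 : H s x = s⁻¹ * (Φ (t₀ + s) x - Φ t₀ x) := by
      rw [hH]
      simp only [h4, Pi.smul_apply, h5, Pi.sub_apply, smul_eq_mul]
    have := hpt _ _ _ (D x) s h2.1 h1.1 hs h6
    simp only [Pi.sub_apply, Pi.smul_apply, smul_eq_mul, hG, h3]
    rw [abs_of_nonneg h1.1, h1.2, h2.2]
    exact this
  rw [Metric.tendsto_nhds]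
  intro η hη
  set M : ℝ := 2 * ‖Φ t₀‖ ^ p + ‖D‖ ^ p with hM
  have hM0 : 0 ≤ M := by positivity
  obtain ⟨C, K, hC, hb⟩ := key (η / (M + 1)) (by positivity)
  set ε := η / (M + 1) with hε
  have hlim : Filter.Tendsto (fun s : ℝ => ε * (2 * ‖Φ t₀‖ ^ p) +
      (C * |s| ^ (p - 1) + ε) * ‖H s‖ ^ p + K * ‖H s - D‖ ^ p)
      (nhdsWithin 0 {0}ᶜ) (nhds (ε * (2 * ‖Φ t₀‖ ^ p) + (0 + ε) * ‖D‖ ^ p + K * 0)) := by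
    have l1 : Filter.Tendsto (fun s : ℝ => C * |s| ^ (p - 1)) (nhdsWithin 0 {0}ᶜ) (nhds 0) := by
      by_cases hp1 : p = 1
      · simp [hC hp1]
      · have hq : 0 < p - 1 := by
          rcases lt_or_eq_of_le hp with h | h
          · linarith
          · exact absurd h.symm hp1
        have : Continuous fun s : ℝ => C * |s| ^ (p - 1) :=
          continuous_const.mul (continuous_abs.rpow_const fun _ => Or.inr hq.le)
        have h := (this.tendsto 0).mono_left (nhdsWithin_le_nhds (s := {0}ᶜ))
        simpa [Real.zero_rpow hq.ne'] using h
    have l2 : Filter.Tendsto (fun s : ℝ => ‖H s‖ ^ p) (nhdsWithin 0 {0}ᶜ) (nhds (‖D‖ ^ p)) :=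
      hslope.norm.rpow_const (Or.inr hp0.le)
    have l3 : Filter.Tendsto (fun s : ℝ => ‖H s - D‖ ^ p) (nhdsWithin 0 {0}ᶜ) (nhds 0) := by
      have := (hslope.sub_const D).norm.rpow_const (p := p) (Or.inr hp0.le)
      simpa [Real.zero_rpow hp0.ne'] using this
    exact (((l1.add_const ε).mul l2).const_add _).add (l3.const_mul K)
  have hlt : ε * (2 * ‖Φ t₀‖ ^ p) + (0 + ε) * ‖D‖ ^ p + K * 0 < η := by
    have : ε * (M + 1) = η := by rw [hε]; field_simp
    have hε0 : 0 < ε := by positivity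
    rw [hM] at this
    nlinarith
  filter_upwards [hlim.eventually_lt_const hlt, self_mem_nhdsWithin] with s hs1 hs2
  rw [Real.dist_eq, sub_zero, abs_of_nonneg ENNReal.toReal_nonneg]
  exact (hb s hs2).trans_lt hs1
end
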